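/- arXiv:1709.07239 — 2 statements merged into one kernel-verified Lean document; each statement's English description precedes it below -/
import Mathlib

section
/- A radial weight ω belongs to Ď if and only if there exist constants C=C(ω)>0 and α=α(ω)>0 such that ŵ(t) ≤ C((1−t)/(1−r))^α ŵ(r) for all 0≤r≤t<1. -/
open MeasureTheory

noncomputable section

/-- `ŵ(r) = ∫_r^1 ω(s) ds`. -/
def wh (ω : ℝ → ℝ) (r : ℝ) : ℝ := ∫ s in r..(1:ℝ), ω s

/-- A radial weight, viewed as a function of the modulus: nonnegative and
integrable on `(0,1)`. -/
def RadialWeight (ω : ℝ → ℝ) : Prop :=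
  (∀ r, 0 ≤ ω r) ∧ IntervalIntegrable ω MeasureTheory.volume 0 1

/-- The class `Ď`. -/
def Dcheck (ω : ℝ → ℝ) : Prop :=
  ∃ K : ℝ, 1 < K ∧ ∃ C : ℝ, 1 < C ∧ ∀ r : ℝ, 0 ≤ r → r < 1 →
    C * wh ω (1 - (1 - r) / K) ≤ wh ω r

lemma wh_anti (ω : ℝ → ℝ) (hω : RadialWeight ω) {a b : ℝ} (ha : 0 ≤ a) (hab : a ≤ b)
    (hb : b ≤ 1) : wh ω b ≤ wh ω a := by
  unfold wh
  have hi : ∀ c d : ℝ, 0 ≤ c → c ≤ d → d ≤ 1 → IntervalIntegrable ω volume c d := by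
    intro c d hc hcd hd
    apply hω.2.mono_set
    rw [Set.uIcc_of_le hcd, Set.uIcc_of_le zero_le_one]
    exact Set.Icc_subset_Icc hc hd
  rw [← intervalIntegral.integral_add_adjacent_intervals (hi a b ha hab hb)
    (hi b 1 (ha.trans hab) hb le_rfl)]
  have := intervalIntegral.integral_nonneg (μ := volume) hab (fun u _ => hω.1 u)
  linarith

lemma wh_nonneg (ω : ℝ → ℝ) (hω : RadialWeight ω) {a : ℝ} (ha : a ≤ 1) : 0 ≤ wh ω a :=
  intervalIntegral.integral_nonneg ha (fun u _ => hω.1 u)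

lemma wh_iter (ω : ℝ → ℝ) {K C : ℝ} (hK : 1 < K) (hC : 1 < C)
    (h : ∀ r : ℝ, 0 ≤ r → r < 1 → C * wh ω (1 - (1 - r) / K) ≤ wh ω r) (n : ℕ) :
    ∀ r : ℝ, 0 ≤ r → r < 1 → C ^ n * wh ω (1 - (1 - r) / K ^ n) ≤ wh ω r := by
  induction n with
  | zero => intro r _ _; simp
  | succ n ih =>
    intro r hr hr1
    have hp : 1 ≤ K ^ n := one_le_pow₀ hK.le
    have hp0 : 0 < K ^ n := by linarith
    have h1 : 0 < (1 - r) / K ^ n := div_pos (by linarith) hp0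
    have h2 : (1 - r) / K ^ n ≤ 1 := by rw [div_le_one hp0]; linarith
    have h3 := h (1 - (1 - r) / K ^ n) (by linarith) (by linarith)
    have e : 1 - (1 - (1 - (1 - r) / K ^ n)) / K = 1 - (1 - r) / K ^ (n + 1) := by
      rw [sub_sub_cancel, div_div, pow_succ]
    rw [e] at h3
    calc C ^ (n + 1) * wh ω (1 - (1 - r) / K ^ (n + 1))
        = C ^ n * (C * wh ω (1 - (1 - r) / K ^ (n + 1))) := by ring
      _ ≤ C ^ n * wh ω (1 - (1 - r) / K ^ n) := by gcongr
      _ ≤ _ := ih r hr hr1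

/-- a radial weight `ω` belongs to `Ď` if and only if there exist
`C > 0` and `α > 0` with `ŵ(t) ≤ C ((1−t)/(1−r))^α ŵ(r)` for all `0 ≤ r ≤ t < 1`. -/
theorem stmt7 (ω : ℝ → ℝ) (hω : RadialWeight ω) :
    Dcheck ω ↔
      ∃ C : ℝ, 0 < C ∧ ∃ α : ℝ, 0 < α ∧
        ∀ r t : ℝ, 0 ≤ r → r ≤ t → t < 1 →
          wh ω t ≤ C * ((1 - t) / (1 - r)) ^ α * wh ω r := by
  constructor
  · rintro ⟨K, hK, C, hC, h⟩
    have hlK := Real.log_pos hK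
    have hlC := Real.log_pos hC
    have hK0 : 0 < K := by linarith
    have hC0 : 0 < C := by linarith
    have hα : 0 < Real.log C / Real.log K := div_pos hlC hlK
    have hKα : K ^ (Real.log C / Real.log K) = C := by
      rw [Real.rpow_def_of_pos hK0, mul_div_cancel₀ _ hlK.ne', Real.exp_log hC0]
    refine ⟨C, hC0, _, hα, ?_⟩
    generalize Real.log C / Real.log K = α at *
    intro r t hr hrt ht
    have ht0 : 0 < 1 - t := by linarith
    have hr0 : 0 < 1 - r := by linarith
    have hx1 : 1 ≤ (1 - r) / (1 - t) := by rw [one_le_div ht0]; linarith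
    obtain ⟨n, hn1, hn2⟩ := exists_nat_pow_near hx1 hK
    have hx0 : 0 < (1 - r) / (1 - t) := by linarith
    have hp0 : 0 < K ^ n := by positivity
    have hp1 : 1 ≤ K ^ n := one_le_pow₀ hK.le
    have e1 : ((1 - r) / (1 - t)) ^ α ≤ C ^ (n + 1) := by
      calc ((1 - r) / (1 - t)) ^ α ≤ (K ^ (n + 1)) ^ α :=
            Real.rpow_le_rpow hx0.le hn2.le hα.le
        _ = C ^ (n + 1) := by rw [← Real.rpow_pow_comm hK0.le, hKα]
    have e2 : wh ω t ≤ wh ω (1 - (1 - r) / K ^ n) := by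
      apply wh_anti ω hω _ _ ht.le
      · have : (1 - r) / K ^ n ≤ 1 := by rw [div_le_one hp0]; linarith
        linarith
      · have : 1 - t ≤ (1 - r) / K ^ n := by
          rw [le_div_iff₀ ht0] at hn1
          rw [le_div_iff₀ hp0]; linarith
        linarith
    have e3 := wh_iter ω hK hC h n r hr (by linarith)
    have e4 : ((1 - t) / (1 - r)) ^ α = (((1 - r) / (1 - t)) ^ α)⁻¹ := by
      rw [← Real.inv_rpow hx0.le, inv_div]
    have hy0 : 0 < ((1 - r) / (1 - t)) ^ α := Real.rpow_pos_of_pos hx0 _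
    have hw := wh_nonneg ω hω ht.le
    rw [e4, mul_right_comm, ← div_eq_mul_inv, le_div_iff₀ hy0]
    calc wh ω t * ((1 - r) / (1 - t)) ^ α ≤ wh ω t * C ^ (n + 1) := by gcongr
      _ = C * (C ^ n * wh ω t) := by ring
      _ ≤ C * (C ^ n * wh ω (1 - (1 - r) / K ^ n)) := by gcongr
      _ ≤ C * wh ω r := by gcongr
  · rintro ⟨C, hC, α, hα, h⟩
    obtain ⟨K, hK2, hK⟩ := (((tendsto_rpow_atTop hα).eventually_ge_atTop (2 * C)).and
      (Filter.eventually_gt_atTop 1)).exists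
    refine ⟨K, hK, 2, one_lt_two, ?_⟩
    intro r hr hr1
    have hK0 : 0 < K := by linarith
    have hr0 : 0 < 1 - r := by linarith
    have h1 : (1 - r) / K ≤ 1 - r := div_le_self hr0.le hK.le
    have h2 : 0 < (1 - r) / K := by positivity
    have h3 := h r (1 - (1 - r) / K) hr (by linarith) (by linarith)
    have e : (1 - (1 - (1 - r) / K)) / (1 - r) = K⁻¹ := by
      field_simp
      ring
    rw [e, Real.inv_rpow hK0.le] at h3
    have hw := wh_nonneg ω hω hr1.le
    have hKp : 0 < K ^ α := Real.rpow_pos_of_pos hK0 _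
    have h4 : C * (K ^ α)⁻¹ ≤ 1 / 2 := by
      rw [← div_eq_mul_inv, div_le_iff₀ hKp]; linarith
    have := mul_le_mul_of_nonneg_right h4 hw
    linarith

end
end

section
/- Let ω be a radial weight. Then the following are equivalent: (i) ω∈D̂, i.e., there exists C≥1 with ŵ(r)≤Cŵ((1+r)/2) for all 0≤r<1; (ii) there exist C=C(ω)>0 and β=β(ω)>0 such that ŵ(r) ≤ C((1−r)/(1−t))^β ŵ(t) for all 0≤r≤t<1; (iii) there exist C=C(ω)>0 and γ=γ(ω)>0 such that ∫_0^t ((1−t)/(1−s))^γ ω(s) ds ≤ C ŵ(t) for all 0≤t<1. -/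
open MeasureTheory

noncomputable section

/-- The class `D̂`. -/
def Dhat (ω : ℝ → ℝ) : Prop :=
  ∃ C : ℝ, 1 ≤ C ∧ ∀ r : ℝ, 0 ≤ r → r < 1 → wh ω r ≤ C * wh ω ((1 + r) / 2)

lemma sw_int {ω : ℝ → ℝ} (hω : RadialWeight ω) {a b : ℝ} (ha : 0 ≤ a) (hab : a ≤ b) (hb : b ≤ 1) :
    IntervalIntegrable ω volume a b := by
  refine hω.2.mono_set ?_
  rw [Set.uIcc_of_le hab, Set.uIcc_of_le zero_le_one]
  exact Set.Icc_subset_Icc ha hb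

lemma sw_split {ω : ℝ → ℝ} (hω : RadialWeight ω) {a b : ℝ} (ha : 0 ≤ a) (hab : a ≤ b) (hb : b ≤ 1) :
    wh ω a = (∫ s in a..b, ω s) + wh ω b := by
  unfold wh
  rw [intervalIntegral.integral_add_adjacent_intervals (sw_int hω ha hab hb)
    (sw_int hω (ha.trans hab) hb le_rfl)]

lemma sw_nn {ω : ℝ → ℝ} (hω : RadialWeight ω) {a : ℝ} (ha : a ≤ 1) : 0 ≤ wh ω a :=
  intervalIntegral.integral_nonneg ha (fun u _ => hω.1 u)

lemma sw_anti {ω : ℝ → ℝ} (hω : RadialWeight ω) {a b : ℝ} (ha : 0 ≤ a) (hab : a ≤ b) (hb : b ≤ 1) :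
    wh ω b ≤ wh ω a := by
  have h := intervalIntegral.integral_nonneg (μ := volume) hab (fun u _ => hω.1 u)
  rw [sw_split hω ha hab hb]; linarith

lemma sw_kint {ω : ℝ → ℝ} (hω : RadialWeight ω) {a b t : ℝ} (γ : ℝ) (ha : 0 ≤ a) (hab : a ≤ b)
    (hb : b ≤ t) (ht : t < 1) :
    IntervalIntegrable (fun s => ((1 - t) / (1 - s)) ^ γ * ω s) volume a b := by
  refine (sw_int hω ha hab (by linarith)).continuousOn_mul ?_
  rw [Set.uIcc_of_le hab]
  refine ContinuousOn.rpow_const ?_ ?_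
  · refine ContinuousOn.div (by fun_prop) (by fun_prop) ?_
    intro x hx
    have := hx.2
    linarith
  · intro x hx
    left
    have := hx.2
    exact (div_pos (by linarith) (by linarith)).ne'

lemma sw_kle {ω : ℝ → ℝ} (hω : RadialWeight ω) {a t γ : ℝ} (hγ : 0 < γ) (ha : 0 ≤ a) (hab : a ≤ t)
    (ht : t < 1) :
    (∫ s in a..t, ((1 - t) / (1 - s)) ^ γ * ω s) ≤ wh ω a := by
  have h1 : (∫ s in a..t, ((1 - t) / (1 - s)) ^ γ * ω s) ≤ ∫ s in a..t, ω s := by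
    refine intervalIntegral.integral_mono_on hab (sw_kint hω γ ha hab le_rfl ht)
      (sw_int hω ha hab ht.le) ?_
    intro x hx
    have hx2 := hx.2
    refine mul_le_of_le_one_left (hω.1 x) ?_
    refine Real.rpow_le_one (div_nonneg (by linarith) (by linarith)) ?_ hγ.le
    rw [div_le_one (by linarith)]; linarith
  have h2 := sw_split hω ha hab ht.le
  have h3 := sw_nn hω ht.le
  linarith

lemma sw_iter {ω : ℝ → ℝ} {C : ℝ} (hC : 1 ≤ C)
    (h : ∀ r : ℝ, 0 ≤ r → r < 1 → wh ω r ≤ C * wh ω ((1 + r) / 2)) (n : ℕ) :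
    ∀ r : ℝ, 0 ≤ r → r < 1 → wh ω r ≤ C ^ n * wh ω (1 - (1 - r) / 2 ^ n) := by
  induction n with
  | zero => intro r _ _; simp
  | succ n ih =>
    intro r h0 h1
    have h2 := ih ((1 + r) / 2) (by linarith) (by linarith)
    have e : 1 - (1 - (1 + r) / 2) / 2 ^ n = 1 - (1 - r) / 2 ^ (n + 1) := by
      field_simp; ring
    rw [e] at h2
    calc wh ω r ≤ C * wh ω ((1 + r) / 2) := h r h0 h1
      _ ≤ C * (C ^ n * wh ω (1 - (1 - r) / 2 ^ (n + 1))) := by gcongr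
      _ = _ := by ring

/-- every `D ≥ 2` is a positive power of 2 -/
lemma sw_exp {D : ℝ} (hD : 2 ≤ D) : ∃ β : ℝ, 0 < β ∧ (2 : ℝ) ^ β = D :=
  ⟨Real.logb 2 D, Real.logb_pos (by norm_num) (by linarith),
    Real.rpow_logb (by norm_num) (by norm_num) (by linarith)⟩

lemma sw_up {ω : ℝ → ℝ} (hω : RadialWeight ω) (h : Dhat ω) :
    ∃ D : ℝ, 2 ≤ D ∧ ∀ r : ℝ, 0 ≤ r → r < 1 → wh ω r ≤ D * wh ω ((1 + r) / 2) := by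
  obtain ⟨C, hC, h⟩ := h
  refine ⟨C + 1, by linarith, fun r h0 h1 => ?_⟩
  have := h r h0 h1
  have := sw_nn hω (a := (1 + r) / 2) (by linarith)
  linarith

lemma sw_12 {ω : ℝ → ℝ} (hω : RadialWeight ω) (h : Dhat ω) :
    ∃ C : ℝ, 0 < C ∧ ∃ β : ℝ, 0 < β ∧
        ∀ r t : ℝ, 0 ≤ r → r ≤ t → t < 1 →
          wh ω r ≤ C * ((1 - r) / (1 - t)) ^ β * wh ω t := by
  obtain ⟨D, hD, h⟩ := sw_up hω h
  obtain ⟨β, hβ, e⟩ := sw_exp hD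
  refine ⟨D, by linarith, β, hβ, fun r t h0 hrt ht => ?_⟩
  have hx : 1 ≤ (1 - r) / (1 - t) := by
    rw [le_div_iff₀ (by linarith)]; linarith
  obtain ⟨n, hn1, hn2⟩ := exists_nat_pow_near hx (y := (2 : ℝ)) (by norm_num)
  have h1 := sw_iter (by linarith) h (n + 1) r h0 (by linarith)
  have hp : (0 : ℝ) < 2 ^ (n + 1) := by positivity
  have hle : (1 - r) / 2 ^ (n + 1) ≤ 1 - t := by
    rw [div_lt_iff₀ (by linarith)] at hn2
    rw [div_le_iff₀ hp]; linarith
  have hq : 0 ≤ (1 - r) / 2 ^ (n + 1) := div_nonneg (by linarith) hp.le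
  have h2 := sw_anti hω (a := t) (b := 1 - (1 - r) / 2 ^ (n + 1)) (by linarith) (by linarith)
    (by linarith)
  have h3 : D ^ n ≤ ((1 - r) / (1 - t)) ^ β := by
    calc D ^ n = ((2 : ℝ) ^ n) ^ β := by
          rw [← e, ← Real.rpow_natCast, ← Real.rpow_natCast, ← Real.rpow_mul (by norm_num),
            ← Real.rpow_mul (by norm_num), mul_comm]
      _ ≤ _ := Real.rpow_le_rpow (by positivity) hn1 hβ.le
  have h4 := sw_nn hω ht.le
  calc wh ω r ≤ D ^ (n + 1) * wh ω (1 - (1 - r) / 2 ^ (n + 1)) := h1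
    _ ≤ D ^ (n + 1) * wh ω t := by gcongr
    _ = D * D ^ n * wh ω t := by ring
    _ ≤ _ := by gcongr

lemma sw_13 {ω : ℝ → ℝ} (hω : RadialWeight ω) (h : Dhat ω) :
    ∃ C : ℝ, 0 < C ∧ ∃ γ : ℝ, 0 < γ ∧
        ∀ t : ℝ, 0 ≤ t → t < 1 →
          (∫ s in (0:ℝ)..t, ((1 - t) / (1 - s)) ^ γ * ω s) ≤ C * wh ω t := by
  obtain ⟨D, hD, h⟩ := sw_up hω h
  obtain ⟨γ, hγ, e⟩ := sw_exp (D := 2 * D) (by linarith)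
  refine ⟨2 * D, by linarith, γ, hγ, ?_⟩
  have key : ∀ n : ℕ, ∀ t : ℝ, 0 ≤ t → t < 1 → 1 < 2 ^ n * (1 - t) →
      (∫ s in (0:ℝ)..t, ((1 - t) / (1 - s)) ^ γ * ω s) ≤ 2 * D * wh ω t := by
    intro n
    induction n with
    | zero => intro t h0 h1 h2; simp at h2; linarith
    | succ n ih =>
      intro t h0 h1 h2
      by_cases hh : t ≤ 1 / 2
      · have a1 := sw_kle hω hγ le_rfl h0 h1
        have a2 := h 0 le_rfl one_pos
        have a3 := sw_anti hω h0 (b := (1 + 0) / 2) (by linarith) (by norm_num)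
        have a4 := sw_nn hω h1.le
        nlinarith
      · push Not at hh
        have hr0 : 0 ≤ 2 * t - 1 := by linarith
        have hrt : 2 * t - 1 ≤ t := by linarith
        have hr1 : 2 * t - 1 < 1 := by linarith
        have b1 := ih (2 * t - 1) hr0 hr1 (by rw [pow_succ] at h2; linarith)
        have b2 := sw_kle hω hγ hr0 hrt h1
        have b3 := h (2 * t - 1) hr0 hr1
        rw [show (1 + (2 * t - 1)) / 2 = t by ring] at b3
        rw [← intervalIntegral.integral_add_adjacent_intervals
          (sw_kint hω γ le_rfl hr0 hrt h1) (sw_kint hω γ hr0 hrt le_rfl h1)]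
        have b4 : (∫ s in (0:ℝ)..(2 * t - 1), ((1 - t) / (1 - s)) ^ γ * ω s) =
            (2 * D)⁻¹ * ∫ s in (0:ℝ)..(2 * t - 1), ((1 - (2 * t - 1)) / (1 - s)) ^ γ * ω s := by
          rw [← intervalIntegral.integral_const_mul]
          refine intervalIntegral.integral_congr ?_
          intro s hs
          rw [Set.uIcc_of_le hr0] at hs
          have hs2 := hs.2
          have : (1 - (2 * t - 1)) / (1 - s) = 2 * ((1 - t) / (1 - s)) := by ring
          simp only
          rw [this, Real.mul_rpow (by norm_num) (div_nonneg (by linarith) (by linarith)), e]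
          have : D ≠ 0 := by linarith
          field_simp
        have b5 : (2 * D)⁻¹ * (∫ s in (0:ℝ)..(2 * t - 1), ((1 - (2 * t - 1)) / (1 - s)) ^ γ * ω s)
            ≤ wh ω (2 * t - 1) := by
          rw [inv_mul_le_iff₀ (by linarith)]; exact b1
        rw [b4]
        linarith
  intro t h0 h1
  obtain ⟨n, hn⟩ := pow_unbounded_of_one_lt (1 / (1 - t)) (one_lt_two (α := ℝ))
  refine key n t h0 h1 ?_
  rwa [div_lt_iff₀ (by linarith)] at hn

lemma sw_31 {ω : ℝ → ℝ} (hω : RadialWeight ω) {C γ : ℝ} (hC : 0 < C) (hγ : 0 < γ)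
    (h : ∀ t : ℝ, 0 ≤ t → t < 1 →
          (∫ s in (0:ℝ)..t, ((1 - t) / (1 - s)) ^ γ * ω s) ≤ C * wh ω t) : Dhat ω := by
  have hp : (0 : ℝ) < 2 ^ γ := by positivity
  refine ⟨1 + 2 ^ γ * C, by nlinarith, fun r h0 h1 => ?_⟩
  set t := (1 + r) / 2 with ht
  have hrt : r ≤ t := by linarith
  have ht1 : t < 1 := by linarith
  have a1 := h t (by linarith) ht1
  rw [← intervalIntegral.integral_add_adjacent_intervals
          (sw_kint hω γ le_rfl h0 hrt ht1) (sw_kint hω γ h0 hrt le_rfl ht1)] at a1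
  have a2 : 0 ≤ ∫ s in (0:ℝ)..r, ((1 - t) / (1 - s)) ^ γ * ω s := by
    refine intervalIntegral.integral_nonneg h0 fun s hs => ?_
    have := hs.2
    exact mul_nonneg (Real.rpow_nonneg (div_nonneg (by linarith) (by linarith)) _) (hω.1 s)
  have a3 : (∫ s in r..t, ω s) ≤ 2 ^ γ * ∫ s in r..t, ((1 - t) / (1 - s)) ^ γ * ω s := by
    rw [← intervalIntegral.integral_const_mul]
    refine intervalIntegral.integral_mono_on hrt (sw_int hω h0 hrt ht1.le)
      ((sw_kint hω γ h0 hrt le_rfl ht1).const_mul _) fun s hs => ?_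
    have hs1 := hs.1
    have hs2 := hs.2
    have hd : 0 ≤ (1 - t) / (1 - s) := div_nonneg (by linarith) (by linarith)
    rw [← mul_assoc, ← Real.mul_rpow (by norm_num) hd]
    refine le_mul_of_one_le_left (hω.1 s) (Real.one_le_rpow ?_ hγ.le)
    rw [← mul_div_assoc, le_div_iff₀ (by linarith)]
    linarith
  have a4 := sw_split hω h0 hrt ht1.le
  have a5 : 2 ^ γ * (∫ s in r..t, ((1 - t) / (1 - s)) ^ γ * ω s) ≤ 2 ^ γ * (C * wh ω t) := by
    gcongr; linarith
  rw [a4]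
  linarith

/-- the three equivalent characterizations of the class `D̂`. -/
theorem stmt19 (ω : ℝ → ℝ) (hω : RadialWeight ω) :
    (Dhat ω ↔
      ∃ C : ℝ, 0 < C ∧ ∃ β : ℝ, 0 < β ∧
        ∀ r t : ℝ, 0 ≤ r → r ≤ t → t < 1 →
          wh ω r ≤ C * ((1 - r) / (1 - t)) ^ β * wh ω t) ∧
    (Dhat ω ↔
      ∃ C : ℝ, 0 < C ∧ ∃ γ : ℝ, 0 < γ ∧
        ∀ t : ℝ, 0 ≤ t → t < 1 →
          (∫ s in (0:ℝ)..t, ((1 - t) / (1 - s)) ^ γ * ω s) ≤ C * wh ω t) := by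
  refine ⟨⟨sw_12 hω, ?_⟩, ⟨sw_13 hω, ?_⟩⟩
  · rintro ⟨C, hC, β, hβ, h⟩
    refine ⟨1 + C * 2 ^ β, by have : 0 < C * 2 ^ β := by positivity
                              linarith, fun r h0 h1 => ?_⟩
    have a1 := h r ((1 + r) / 2) h0 (by linarith) (by linarith)
    have e : (1 - r) / (1 - (1 + r) / 2) = 2 := by
      rw [div_eq_iff (by linarith)]; ring
    rw [e] at a1
    have := sw_nn hω (a := (1 + r) / 2) (by linarith)
    linarith
  · rintro ⟨C, hC, γ, hγ, h⟩
    exact sw_31 hω hC hγ h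

end
end
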